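/- For every k ≥ 1, the truncated Thue–Morse morphism h_k is 3^+-free: for every finite binary word w with ce(w) ≤ 3, one has ce(h_k(w)) ≤ 3. -/

import Mathlib

/-- The Thue–Morse word: `tm n` is the parity of the number of 1s in the
binary representation of `n` (`true` = letter 1, `false` = letter 0). -/
def tm (n : ℕ) : Bool := ((Nat.digits 2 n).count 1) % 2 == 1

/-- The factor `t[ℓ..ℓ+k-1]` of the Thue–Morse word. -/
def tmFactor (ℓ k : ℕ) : List Bool := (List.range k).map (fun i => tm (ℓ + i))

/-- Complement of a binary word (exchange 0 and 1 in every position). -/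
def wcompl (w : List Bool) : List Bool := w.map (fun b => !b)

/-- Apply the binary morphism `0 ↦ h0, 1 ↦ h1` to the word `w`. -/
def applyMorph (h0 h1 : List Bool) (w : List Bool) : List Bool :=
  (w.map (fun b => bif b then h1 else h0)).flatten

/-- The Thue–Morse morphism μ : 0 ↦ 01, 1 ↦ 10. -/
def mu : List Bool → List Bool := applyMorph [false, true] [true, false]

/-- `p` is a period of the finite word `w`: `1 ≤ p ≤ |w|` and `w[i] = w[i+p]`
for all `i` with `i + p < |w|`. -/
def HasPeriodW (w : List Bool) (p : ℕ) : Prop :=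
  1 ≤ p ∧ p ≤ w.length ∧ ∀ i, i + p < w.length → w.getD i false = w.getD (i + p) false

/-- The smallest period of `w`. -/
noncomputable def per (w : List Bool) : ℕ := sInf {p | HasPeriodW w p}

/-- The exponent of `w`: `|w| / per(w)`. -/
noncomputable def wexp (w : List Bool) : ℝ := (w.length : ℝ) / (per w : ℝ)

/-- The critical exponent of `w`: supremum of exponents of nonempty factors of `w`. -/
noncomputable def ce (w : List Bool) : ℝ :=
  sSup {r : ℝ | ∃ x : List Bool, x ≠ [] ∧ x <:+: w ∧ r = wexp x}

/-- A `k`-prefix: the length-`k` prefix of the Thue–Morse word, or its complement. -/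
def kPrefix (k : ℕ) (s : List Bool) : Prop :=
  s = tmFactor 0 k ∨ s = wcompl (tmFactor 0 k)

/-- `v` is a finite factor of the Thue–Morse word. -/
def IsTMFactor (v : List Bool) : Prop := ∃ ℓ, v = tmFactor ℓ v.length

/-- The complementary morphism `0 ↦ h0, 1 ↦ complement of h0` is cubefree:
it maps every word of critical exponent `< 3` to a word of critical exponent `< 3`. -/
def CubefreeC (h0 : List Bool) : Prop :=
  ∀ w : List Bool, ce w < 3 → ce (applyMorph h0 (wcompl h0) w) < 3

/-- The word `x` occurs at position `i` of the word `w`. -/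
def OccursAt (x w : List Bool) (i : ℕ) : Prop :=
  i + x.length ≤ w.length ∧ (w.drop i).take x.length = x

/-! ### The Thue–Morse word -/

theorem xor_eq_xor_of_xor_eq_xor {a b c d : Bool} (h : (a ^^ b) = (c ^^ d)) :
    (b ^^ d) = (a ^^ c) := by
  revert a b c d; decide

theorem tm_two_mul (n : ℕ) : tm (2 * n) = tm n := by
  rcases Nat.eq_zero_or_pos n with rfl | hn
  · rfl
  · unfold tm
    rw [Nat.digits_def' (by norm_num) (by omega)]
    simp

theorem tm_two_mul_add_one (n : ℕ) : tm (2 * n + 1) = !tm n := by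
  unfold tm
  rw [Nat.digits_def' (by norm_num) (by omega), show (2 * n + 1) % 2 = 1 by omega,
    show (2 * n + 1) / 2 = n by omega, List.count_cons_self]
  generalize List.count 1 (Nat.digits 2 n) = c
  rcases Nat.mod_two_eq_zero_or_one c with h | h <;> simp [Nat.add_mod, h]

theorem tm_zero : tm 0 = false := by simp [tm]

theorem tm_one : tm 1 = true := by simp [tm]

theorem tm_two : tm 2 = true := by rw [show 2 = 2 * 1 from rfl, tm_two_mul, tm_one]

/-- Equal adjacent letters of the Thue–Morse word start at an odd position. -/
theorem odd_of_tm_eq_succ {n : ℕ} (h : tm n = tm (n + 1)) : n % 2 = 1 := by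
  by_contra hn
  obtain ⟨m, rfl⟩ : ∃ m, n = 2 * m := ⟨n / 2, by omega⟩
  rw [tm_two_mul, tm_two_mul_add_one] at h
  simp at h

theorem tm_two_mul_add_mod (n a : ℕ) : tm (2 * n + a % 2) = (tm n ^^ tm (a % 2)) := by
  rcases Nat.mod_two_eq_zero_or_one a with h | h <;> rw [h]
  · simp [tm_two_mul, tm_zero]
  · simp [tm_two_mul_add_one, tm_one]

/-- No prefix of the Thue–Morse word is a square. -/
theorem tm_prefix_not_square (r : ℕ) (hr : 1 ≤ r) : ¬ ∀ s < r, tm s = tm (s + r) := by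
  induction r using Nat.strong_induction_on with
  | _ r ih =>
    intro h
    rcases Nat.even_or_odd' r with ⟨m, rfl | rfl⟩
    · refine ih m (by omega) (by omega) fun s hs => ?_
      have := h (2 * s) (by omega)
      rwa [← Nat.mul_add, tm_two_mul, tm_two_mul] at this
    · rcases Nat.eq_zero_or_pos m with rfl | hm
      · have := h 0 (by omega)
        simp [tm_zero, tm_one] at this
      · have h1 := h 1 (by omega)
        have h2 := h 2 (by omega)
        rw [tm_one, ← tm_two, h2] at h1
        have := odd_of_tm_eq_succ (n := 1 + (2 * m + 1))
          (by rw [← h1]; congr 1; omega)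
        omega

/-- The Thue–Morse word is overlap-free. -/
theorem tm_overlapFree (r : ℕ) (hr : 1 ≤ r) (a : ℕ) :
    ¬ ∀ s ≤ r, tm (a + s) = tm (a + s + r) := by
  induction r using Nat.strong_induction_on generalizing a with
  | _ r ih =>
    intro h
    rcases Nat.even_or_odd' r with ⟨m, rfl | rfl⟩
    · refine ih m (by omega) (by omega) (a / 2) fun s hs => ?_
      have := h (2 * s) (by omega)
      rw [show a + 2 * s = 2 * (a / 2 + s) + a % 2 by omega,
        show 2 * (a / 2 + s) + a % 2 + 2 * m = 2 * (a / 2 + s + m) + a % 2 by omega,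
        tm_two_mul_add_mod, tm_two_mul_add_mod] at this
      simpa using this
    · have alt : ∀ s < 2 * m + 1, tm (a + s + 1) = !tm (a + s) := by
        intro s hs
        have h1 := h s (by omega)
        have h2 := h (s + 1) (by omega)
        by_contra hne
        have he : tm (a + s) = tm (a + s + 1) := by
          revert hne; cases tm (a + s + 1) <;> cases tm (a + s) <;> simp
        have o1 := odd_of_tm_eq_succ he
        have o2 := odd_of_tm_eq_succ (n := a + s + (2 * m + 1)) (by
          rw [← h1, he, add_assoc a s 1, h2]; congr 1; omega)
        omega
      have step : ∀ s ≤ m, tm (a + 2 * s) = tm a := by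
        intro s
        induction s with
        | zero => simp
        | succ s ihs =>
          intro hs
          rw [show a + 2 * (s + 1) = a + (2 * s + 1) + 1 by ring, alt _ (by omega),
            show a + (2 * s + 1) = a + 2 * s + 1 by ring, alt _ (by omega), ihs (by omega)]
          simp
      have h0 := h 0 (by omega)
      rw [show a + 0 + (2 * m + 1) = a + 2 * m + 1 by ring, alt _ (by omega),
        step m le_rfl] at h0
      simp at h0

/-- A prefix of length `k` of the Thue–Morse word that agrees with its shift by `r`,
possibly up to complement, has length at most `2 * r`. -/
theorem tm_prefix_length_le {k r : ℕ} (hr : 1 ≤ r) {c : Bool}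
    (h : ∀ s, s + r < k → (tm s ^^ tm (s + r)) = c) : k ≤ 2 * r := by
  by_contra hk
  have h0 := h 0 (by omega)
  have h1 := h r (by omega)
  rw [← two_mul, tm_two_mul, Bool.xor_self] at h1
  refine tm_prefix_not_square r hr fun s hs => ?_
  simpa [← h1] using h s (by omega)

/-! ### Cube-overlaps in infinite words -/

/-- Some factor of `f 0 ⋯ f (n - 1)` has length `3 * p + 1` and period `p` for some `p ≥ 1`. -/
def HasCubeOverlap (f : ℕ → Bool) (n : ℕ) : Prop :=
  ∃ x p, 1 ≤ p ∧ x + 3 * p < n ∧ ∀ i, x ≤ i → i ≤ x + 2 * p → f i = f (i + p)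

/-- The image of the infinite word `f` under the truncated Thue–Morse morphism `h_k`. -/
def tmImage (k : ℕ) (f : ℕ → Bool) (i : ℕ) : Bool := f (i / k) ^^ tm (i % k)

theorem tmImage_block {k : ℕ} (f : ℕ → Bool) (j : ℕ) {s : ℕ} (hs : s < k) :
    tmImage k f (j * k + s) = (f j ^^ tm s) := by
  unfold tmImage
  rw [Nat.add_comm, Nat.add_mul_div_right _ _ (by omega), Nat.add_mul_mod_self_right,
    Nat.div_eq_of_lt hs, Nat.mod_eq_of_lt hs, Nat.zero_add]

theorem tmImage_two_mul (k : ℕ) (f : ℕ → Bool) (i : ℕ) :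
    tmImage (2 * k) f (2 * i) = tmImage k f i := by
  simp [tmImage, Nat.mul_div_mul_left, Nat.mul_mod_mul_left, tm_two_mul]

theorem tmImage_two_mul_add_one (k : ℕ) (f : ℕ → Bool) (i : ℕ) :
    tmImage (2 * k) f (2 * i + 1) = !tmImage k f i := by
  unfold tmImage
  rw [Nat.mod_mul, ← Nat.div_div_eq_div_mul, show (2 * i + 1) / 2 = i by omega,
    show (2 * i + 1) % 2 = 1 by omega, Nat.add_comm 1, tm_two_mul_add_one]
  simp

theorem tmImage_two_mul_add_mod (k : ℕ) (f : ℕ → Bool) (i a : ℕ) :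
    tmImage (2 * k) f (2 * i + a % 2) = (tmImage k f i ^^ tm (a % 2)) := by
  rcases Nat.mod_two_eq_zero_or_one a with h | h <;> rw [h]
  · simp [tmImage_two_mul, tm_zero]
  · simp [tmImage_two_mul_add_one, tm_one]

/-- A cube-overlap in `h_{2k}(f) = μ(h_k(f))` comes from one in `h_k(f)`. -/
theorem HasCubeOverlap.of_two_mul {k : ℕ} {f : ℕ → Bool} {n : ℕ}
    (h : HasCubeOverlap (tmImage (2 * k) f) (2 * k * n)) :
    HasCubeOverlap (tmImage k f) (k * n) := by
  obtain ⟨x, p, hp, hx, h⟩ := h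
  rw [mul_assoc] at hx
  rcases Nat.even_or_odd' p with ⟨q, rfl | rfl⟩
  · refine ⟨x / 2, q, by omega, by omega, fun i hi hi' => ?_⟩
    have := h (2 * i + x % 2) (by omega) (by omega)
    rw [show 2 * i + x % 2 + 2 * q = 2 * (i + q) + x % 2 by ring,
      tmImage_two_mul_add_mod, tmImage_two_mul_add_mod] at this
    simpa using this
  · have heven : ∀ m, x ≤ 2 * m → 2 * m ≤ x + 2 * (2 * q + 1) →
        tmImage k f m = !tmImage k f (m + q) := by
      intro m h1 h2
      have := h _ h1 h2
      rwa [tmImage_two_mul, show 2 * m + (2 * q + 1) = 2 * (m + q) + 1 by ring,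
        tmImage_two_mul_add_one] at this
    have hodd : ∀ m, x ≤ 2 * m + 1 → 2 * m + 1 ≤ x + 2 * (2 * q + 1) →
        (!tmImage k f m) = tmImage k f (m + q + 1) := by
      intro m h1 h2
      have := h _ h1 h2
      rwa [tmImage_two_mul_add_one, show 2 * m + 1 + (2 * q + 1) = 2 * (m + q + 1) by ring,
        tmImage_two_mul] at this
    rcases Nat.eq_zero_or_pos q with rfl | hq
    · have := heven ((x + 1) / 2) (by omega) (by omega)
      simp at this
    · refine ⟨(x + 1) / 2 + q, 1, le_rfl, by omega, fun i hi hi' => ?_⟩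
      have h1 := heven (i - q) (by omega) (by omega)
      have h2 := hodd (i - q) (by omega) (by omega)
      rw [show i - q + q = i by omega] at h1 h2
      rw [← h2, h1, Bool.not_not]

/-- A period `r` modulo `k` cannot be matched on a whole block of odd length `k`. -/
theorem not_match_full_block {k r : ℕ} (hodd : k % 2 = 1) (hr : 1 ≤ r) (hrk : r < k) {c d e : Bool}
    (h1 : ∀ s < k, s + r < k → (c ^^ tm s) = (d ^^ tm (s + r)))
    (h2 : ∀ s < k, k ≤ s + r → (c ^^ tm s) = (e ^^ tm (s + r - k))) : False := by
  have A : k ≤ 2 * r := tm_prefix_length_le hr (c := c ^^ d) fun s hs =>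
    xor_eq_xor_of_xor_eq_xor (h1 s (by omega) hs)
  have B : k ≤ 2 * (k - r) := tm_prefix_length_le (by omega) (c := c ^^ e) fun s hs => by
    have := h2 (s + (k - r)) hs (by omega)
    rw [show s + (k - r) + r - k = s by omega] at this
    rw [Bool.xor_comm (tm s), xor_eq_xor_of_xor_eq_xor this]
  omega

/-- A period `r < k` cannot be matched on `2 * r + 1` positions that straddle two consecutive
blocks of odd length `k` without containing either of them. -/
theorem not_match_straddle {k r a b : ℕ} (hodd : k % 2 = 1) (hr : 1 ≤ r) (hrk : r < k)
    (ha : 1 ≤ a) (hb : 1 ≤ b) (hbk : b < k) (hab : b + k = a + 2 * r + 1) {c d e : Bool}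
    (h1 : ∀ s, a ≤ s → s + r < k → tm s = tm (s + r))
    (h2 : ∀ s, a ≤ s → s < k → k ≤ s + r → (c ^^ tm s) = (d ^^ tm (s + r - k)))
    (h3 : ∀ s < b, s + r < k → tm s = tm (s + r))
    (h4 : ∀ s < b, k ≤ s + r → (d ^^ tm s) = (e ^^ tm (s + r - k))) : False := by
  rcases Nat.lt_or_ge k (b + r) with hbr | hbr
  · have hk : k < 2 * r := by
      by_contra hk
      exact tm_prefix_not_square r hr fun s hs => h3 s (by omega) (by omega)
    have hcd : (c ^^ d) = (d ^^ e) := by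
      have e1 := h2 (max a (k - r)) (by omega) (by omega) (by omega)
      have e2 := h4 (max a (k - r)) (by omega) (by omega)
      rw [← xor_eq_xor_of_xor_eq_xor e1, ← xor_eq_xor_of_xor_eq_xor e2]
    have := tm_prefix_length_le (k := k) (r := k - r) (by omega) (c := c ^^ d) fun s hs => by
      rcases Nat.lt_or_ge (s + (k - r)) b with hsb | hsb
      · have := h4 (s + (k - r)) hsb (by omega)
        rw [show s + (k - r) + r - k = s by omega] at this
        rw [Bool.xor_comm (tm s), xor_eq_xor_of_xor_eq_xor this, hcd]
      · have := h2 (s + (k - r)) (by omega) hs (by omega)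
        rw [show s + (k - r) + r - k = s by omega] at this
        rw [Bool.xor_comm (tm s), xor_eq_xor_of_xor_eq_xor this]
    omega
  · have hb' : b < r := by
      by_contra hb'
      exact tm_prefix_not_square r hr fun s hs => h3 s (by omega) (by omega)
    have hr3 : 3 ≤ r := by
      by_contra hr3
      have hr2 : r = 2 := by omega
      have := h3 0 (by omega) (by omega)
      simp [hr2, tm_zero, tm_two] at this
    have hD : tm (k - r + 1) = tm (k - r + 2) := by
      have e1 := h2 (k - r + 1) (by omega) (by omega) (by omega)
      have e2 := h2 (k - r + 2) (by omega) (by omega) (by omega)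
      rw [show k - r + 1 + r - k = 1 by omega, tm_one] at e1
      rw [show k - r + 2 + r - k = 2 by omega, tm_two] at e2
      rw [← e2] at e1
      simpa using e1
    have o1 := odd_of_tm_eq_succ hD
    rcases Nat.lt_or_ge b 3 with hb3 | hb3
    · have e1 := h1 (k - 2 * r + 1) (by omega) (by omega)
      have e2 := h1 (k - 2 * r + 2) (by omega) (by omega)
      rw [show k - 2 * r + 1 + r = k - r + 1 by omega] at e1
      rw [show k - 2 * r + 2 + r = k - r + 2 by omega] at e2
      have o2 := odd_of_tm_eq_succ (e1.trans (hD.trans e2.symm))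
      omega
    · have e1 := h3 1 (by omega) (by omega)
      have e2 := h3 2 (by omega) (by omega)
      rw [tm_one, Nat.add_comm] at e1
      rw [tm_two, Nat.add_comm] at e2
      have o2 := odd_of_tm_eq_succ (e1.symm.trans e2)
      omega

theorem HasCubeOverlap.of_odd {k : ℕ} (hodd : k % 2 = 1) {f : ℕ → Bool} {n : ℕ}
    (h : HasCubeOverlap (tmImage k f) (k * n)) : HasCubeOverlap f n := by
  obtain ⟨x, p, hp, hx, h⟩ := h
  have hk : 0 < k := by omega
  obtain ⟨q, r, hr, rfl⟩ : ∃ q r, r < k ∧ p = q * k + r :=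
    ⟨p / k, p % k, Nat.mod_lt _ hk, (Nat.div_add_mod' p k).symm⟩
  obtain ⟨j, a, ha, rfl⟩ : ∃ j a, a < k ∧ x = j * k + a :=
    ⟨x / k, x % k, Nat.mod_lt _ hk, (Nat.div_add_mod' x k).symm⟩
  have low : ∀ l s, s < k → j * k + a ≤ l * k + s →
      l * k + s ≤ j * k + a + 2 * (q * k + r) → s + r < k →
      (f l ^^ tm s) = (f (l + q) ^^ tm (s + r)) := by
    intro l s hs h1 h2 hsr
    have := h _ h1 h2
    rwa [tmImage_block f l hs, show l * k + s + (q * k + r) = (l + q) * k + (s + r) by ring,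
      tmImage_block f _ hsr] at this
  have high : ∀ l s, s < k → j * k + a ≤ l * k + s →
      l * k + s ≤ j * k + a + 2 * (q * k + r) → k ≤ s + r →
      (f l ^^ tm s) = (f (l + q + 1) ^^ tm (s + r - k)) := by
    intro l s hs h1 h2 hsr
    have := h _ h1 h2
    rwa [tmImage_block f l hs, show l * k + s + (q * k + r) = (l + q + 1) * k + (s + r - k) by
      zify [hsr]; ring, tmImage_block f _ (by omega)] at this
  rcases Nat.eq_zero_or_pos r with rfl | hr0
  · have hq : 1 ≤ q := Nat.one_le_iff_ne_zero.2 fun hq => by simp [hq] at hp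
    refine ⟨j, q, hq, ?_, fun i hi hi' => ?_⟩
    · have : k * (j + 3 * q) < k * n := by
        calc k * (j + 3 * q) = j * k + 3 * (q * k + 0) := by ring
          _ < k * n := by omega
      exact Nat.lt_of_mul_lt_mul_left this
    · rcases Nat.eq_or_lt_of_le hi with rfl | hlt
      · simpa using low j a ha (by omega) (by omega) (by omega)
      · have e1 : (j + 1) * k ≤ i * k := Nat.mul_le_mul_right _ hlt
        have e2 : i * k ≤ (j + 2 * q) * k := Nat.mul_le_mul_right _ hi'
        simpa using low i 0 hk (by linarith) (by linarith) (by omega)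
  · exfalso
    have hj : (j + 1) * k = j * k + k := by ring
    rcases Nat.eq_zero_or_pos a with rfl | ha0
    · rcases Nat.lt_or_ge (2 * (q * k + r)) (k - 1) with hs | hs
      · have hq : q = 0 := by
          by_contra hq
          have : 1 * k ≤ q * k := Nat.mul_le_mul_right _ (by omega)
          omega
        subst hq
        refine tm_overlapFree r hr0 0 fun s hs => ?_
        simpa using low j (0 + s) (by omega) (by omega) (by omega) (by omega)
      · exact not_match_full_block hodd hr0 hr
          (fun s hs => low j s hs (by omega) (by omega))
          (fun s hs => high j s hs (by omega) (by omega))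
    · rcases Nat.lt_or_ge (a + 2 * (q * k + r)) (2 * k - 1) with hs | hs
      · have hq : q = 0 := by
          by_contra hq
          have : 1 * k ≤ q * k := Nat.mul_le_mul_right _ (by omega)
          omega
        subst hq
        rcases Nat.lt_or_ge (a + 2 * r) k with hs' | hs'
        · refine tm_overlapFree r hr0 a fun s hs => ?_
          simpa using low j (a + s) (by omega) (by omega) (by omega) (by omega)
        · refine not_match_straddle (b := a + 2 * r + 1 - k) hodd hr0 hr ha0 (by omega) (by omega)
            (by omega) (c := f j) (d := f (j + 1)) (e := f (j + 2)) ?_ ?_ ?_ ?_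
          · intro s h1 h2
            simpa using low j s (by omega) (by omega) (by omega) h2
          · intro s h1 h2 h3
            simpa using high j s h2 (by omega) (by omega) h3
          · intro s h1 h2
            simpa using low (j + 1) s (by omega) (by omega) (by omega) h2
          · intro s h1 h2
            simpa using high (j + 1) s (by omega) (by omega) (by omega) h2
      · exact not_match_full_block hodd hr0 hr
          (fun s hs => low (j + 1) s hs (by omega) (by omega))
          (fun s hs => high (j + 1) s hs (by omega) (by omega))

/-- The truncated Thue–Morse morphisms do not create cube-overlaps. -/
theorem HasCubeOverlap.of_tmImage {k : ℕ} (hk : 1 ≤ k) {f : ℕ → Bool} {n : ℕ}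
    (h : HasCubeOverlap (tmImage k f) (k * n)) : HasCubeOverlap f n := by
  induction k using Nat.strong_induction_on with
  | _ k ih =>
    rcases Nat.even_or_odd' k with ⟨m, rfl | rfl⟩
    · exact ih m (by omega) (by omega) h.of_two_mul
    · exact h.of_odd (by omega)

/-! ### Critical exponents and cube-overlaps of finite words -/

theorem hasPeriodW_per {x : List Bool} (hx : x ≠ []) : HasPeriodW x (per x) :=
  Nat.sInf_mem (s := {p | HasPeriodW x p})
    ⟨x.length, List.length_pos_iff.2 hx, le_rfl, fun i hi => by omega⟩

theorem getD_append_append (s x u : List Bool) {i : ℕ} (hi : i < x.length) :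
    (s ++ x ++ u).getD (s.length + i) false = x.getD i false := by
  rw [List.append_assoc, List.getD_append_right _ _ _ _ (by omega), Nat.add_sub_cancel_left,
    List.getD_append _ _ _ _ hi]

theorem ce_le_three_of_not_hasCubeOverlap {w : List Bool}
    (h : ¬ HasCubeOverlap (fun i => w.getD i false) w.length) : ce w ≤ 3 := by
  refine Real.sSup_le ?_ (by norm_num)
  rintro _ ⟨x, hx, ⟨s, u, rfl⟩, rfl⟩
  obtain ⟨h1, -, h3⟩ := hasPeriodW_per hx
  unfold wexp
  rw [div_le_iff₀ (by exact_mod_cast h1)]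
  by_contra hlt
  have hlt : 3 * per x < x.length := by exact_mod_cast not_le.1 hlt
  refine h ⟨s.length, per x, h1, by simp; omega, fun i hi hi' => ?_⟩
  obtain ⟨i, rfl⟩ := Nat.exists_eq_add_of_le hi
  beta_reduce
  rw [add_assoc, getD_append_append _ _ _ (by omega), getD_append_append _ _ _ (by omega)]
  exact h3 i (by omega)

theorem wexp_le_ce {w x : List Bool} (hx : x ≠ []) (hxw : x <:+: w) : wexp x ≤ ce w := by
  refine le_csSup ⟨w.length, ?_⟩ ⟨x, hx, hxw, rfl⟩
  rintro _ ⟨y, hy, hyw, rfl⟩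
  have h1 : (1 : ℝ) ≤ per y := by exact_mod_cast (hasPeriodW_per hy).1
  exact (div_le_self (by positivity) h1).trans (by exact_mod_cast hyw.length_le)

theorem not_hasCubeOverlap_of_ce_le_three {w : List Bool} (hw : ce w ≤ 3) :
    ¬ HasCubeOverlap (fun i => w.getD i false) w.length := by
  rintro ⟨a, p, hp, ha, h⟩
  set x := (w.drop a).take (3 * p + 1) with hxdef
  have hlen : x.length = 3 * p + 1 := by simp [hxdef]; omega
  have hx : x ≠ [] := List.ne_nil_of_length_eq_add_one hlen
  have hget : ∀ i < 3 * p + 1, x.getD i false = w.getD (a + i) false := by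
    intro i hi
    simp [hxdef, List.getD_eq_getElem?_getD, hi]
  have hper : HasPeriodW x p := by
    refine ⟨hp, by omega, fun i hi => ?_⟩
    rw [hget _ (by omega), hget _ (by omega), ← add_assoc]
    exact h _ (by omega) (by omega)
  have hle : wexp x ≤ 3 :=
    (wexp_le_ce hx ((List.take_prefix _ _).isInfix.trans (List.drop_suffix _ _).isInfix)).trans hw
  unfold wexp at hle
  rw [div_le_iff₀ (by exact_mod_cast (hasPeriodW_per hx).1)] at hle
  have hle' : x.length ≤ 3 * per x := by exact_mod_cast hle
  have : per x ≤ p := Nat.sInf_le hper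
  omega

theorem length_applyMorph_tmFactor (k : ℕ) (w : List Bool) :
    (applyMorph (tmFactor 0 k) (wcompl (tmFactor 0 k)) w).length = k * w.length := by
  induction w with
  | nil => simp [applyMorph]
  | cons b w ih =>
    unfold applyMorph at ih
    cases b <;> simp [applyMorph, tmFactor, wcompl] at ih ⊢ <;> rw [ih] <;> ring

theorem getD_applyMorph_tmFactor {k : ℕ} (w : List Bool) {i : ℕ} (hi : i < k * w.length) :
    (applyMorph (tmFactor 0 k) (wcompl (tmFactor 0 k)) w).getD i false =
      tmImage k (fun j => w.getD j false) i := by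
  induction w generalizing i with
  | nil => simp at hi
  | cons b w ih =>
    have hk : 0 < k := Nat.pos_of_ne_zero fun hk => by simp [hk] at hi
    have hcons : applyMorph (tmFactor 0 k) (wcompl (tmFactor 0 k)) (b :: w) =
        (tmFactor 0 k).map (fun c => b ^^ c) ++
          applyMorph (tmFactor 0 k) (wcompl (tmFactor 0 k)) w := by
      cases b <;> simp [applyMorph, wcompl]
    rw [hcons]
    rcases Nat.lt_or_ge i k with hik | hik
    · rw [List.getD_append _ _ _ _ (by simpa [tmFactor] using hik)]
      simp [tmImage, Nat.div_eq_of_lt hik, Nat.mod_eq_of_lt hik, tmFactor,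
        List.getD_eq_getElem?_getD, hik]
    · obtain ⟨i, rfl⟩ := Nat.exists_eq_add_of_le' hik
      rw [List.getD_append_right _ _ _ _ (by simp [tmFactor]), List.length_map,
        show (tmFactor 0 k).length = k by simp [tmFactor], Nat.add_sub_cancel,
        ih (by rw [List.length_cons, mul_add] at hi; omega)]
      simp [tmImage, Nat.add_div_right _ hk]

/-- for every `k ≥ 1`, the truncated Thue–Morse morphism `h_k`
is `3⁺`-free. -/
theorem stmt2 (k : ℕ) (hk : 1 ≤ k) (w : List Bool) (hw : ce w ≤ (3 : ℝ)) :
    ce (applyMorph (tmFactor 0 k) (wcompl (tmFactor 0 k)) w) ≤ 3 := by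
  refine ce_le_three_of_not_hasCubeOverlap fun h =>
    not_hasCubeOverlap_of_ce_le_three hw (HasCubeOverlap.of_tmImage hk ?_)
  obtain ⟨x, p, hp, hx, h⟩ := h
  rw [length_applyMorph_tmFactor] at hx
  refine ⟨x, p, hp, hx, fun i hi hi' => ?_⟩
  rw [← getD_applyMorph_tmFactor w (by omega), ← getD_applyMorph_tmFactor w (by omega)]
  exact h i hi hi'
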